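/- arXiv:1501.06630 — 2 statements merged into one kernel-verified Lean document; each statement's English description precedes it below -/
import Mathlib

section
/- Let (ξ₁, ξ₂) ~ N((πβ, π)', Σ) with Σ positive definite and π > 0. Define β̂_U = τ̂(ξ₂,σ₂²)(ξ₁ − (σ₁₂/σ₂²)ξ₂) + σ₁₂/σ₂² with τ̂(ξ₂,σ₂²) = (1/σ₂)(1 − Φ(ξ₂/σ₂))/φ(ξ₂/σ₂). There exists a constant K depending only on β and Σ (not on π) such that π·E[|β̂_U − β|] ≤ K for all π > 0. -/
open MeasureTheory ProbabilityTheory Filter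

/-- Standard normal density `φ`. -/
noncomputable def stdPDF (x : ℝ) : ℝ :=
  (Real.sqrt (2 * Real.pi))⁻¹ * Real.exp (-(x ^ 2) / 2)

/-- Standard normal CDF `Φ`. -/
noncomputable def stdCDF (x : ℝ) : ℝ := ∫ t in Set.Iic x, stdPDF t

/-- Mills-ratio estimator `τ̂(x, σ²) = (1/σ)(1 − Φ(x/σ))/φ(x/σ)`. -/
noncomputable def millsTau (σ x : ℝ) : ℝ :=
  (1 / σ) * (1 - stdCDF (x / σ)) / stdPDF (x / σ)

/-- Mills ratio. -/
noncomputable def millsR (x : ℝ) : ℝ := (1 - stdCDF x) / stdPDF x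

lemma stdPDF_eq : stdPDF = gaussianPDFReal 0 1 := by
  ext x; simp [stdPDF, gaussianPDFReal]

lemma stdPDF_pos (x : ℝ) : 0 < stdPDF x := by unfold stdPDF; positivity

lemma integrable_stdPDF : Integrable stdPDF := by
  rw [stdPDF_eq]; exact integrable_gaussianPDFReal 0 1

lemma one_sub_stdCDF (x : ℝ) : 1 - stdCDF x = ∫ t in Set.Ioi x, stdPDF t := by
  have h : ∫ t, stdPDF t = 1 := by
    rw [stdPDF_eq]; exact integral_gaussianPDFReal_eq_one 0 one_ne_zero
  have h2 := integral_add_compl (measurableSet_Iic (a := x)) integrable_stdPDF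
  rw [Set.compl_Iic, h] at h2
  unfold stdCDF
  linarith

lemma stdPDF_add (x u : ℝ) :
    stdPDF (u + x) = stdPDF x * Real.exp (-x * u - u ^ 2 / 2) := by
  unfold stdPDF
  rw [mul_assoc, ← Real.exp_add]
  congr 2; ring

lemma integrable_kern (x : ℝ) : Integrable (fun u => Real.exp (-x * u - u ^ 2 / 2)) := by
  have h := (integrable_stdPDF.comp_add_right x).const_mul (stdPDF x)⁻¹
  refine h.congr (Eventually.of_forall fun u => ?_)
  have := (stdPDF_pos x).ne'
  simp only [stdPDF_add]
  field_simp

lemma millsR_eq (x : ℝ) : millsR x = ∫ u in Set.Ioi 0, Real.exp (-x * u - u ^ 2 / 2) := by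
  unfold millsR
  rw [one_sub_stdCDF, div_eq_iff (stdPDF_pos x).ne', mul_comm, ← integral_const_mul]
  have h := (measurePreserving_add_right volume x).setIntegral_preimage_emb
    (measurableEmbedding_addRight x) stdPDF (Set.Ioi x)
  rw [← h]
  simp only [Set.preimage_add_const_Ioi, sub_self, stdPDF_add]

lemma millsR_nonneg (x : ℝ) : 0 ≤ millsR x := by
  rw [millsR_eq]; exact integral_nonneg fun u => (Real.exp_pos _).le

lemma ofReal_millsR (x : ℝ) : ENNReal.ofReal (millsR x) =
    ∫⁻ u in Set.Ioi 0, ENNReal.ofReal (Real.exp (-x * u - u ^ 2 / 2)) := by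
  rw [millsR_eq, ofReal_integral_eq_lintegral_ofReal (integrable_kern x).integrableOn]
  exact Eventually.of_forall fun u => (Real.exp_pos _).le

lemma measurable_millsR : Measurable millsR := by
  have h : millsR = fun x => (∫⁻ u in Set.Ioi (0:ℝ),
      ENNReal.ofReal (Real.exp (-x * u - u ^ 2 / 2))).toReal := by
    ext x
    rw [← ofReal_millsR, ENNReal.toReal_ofReal (millsR_nonneg x)]
  rw [h]
  refine Measurable.ennreal_toReal ?_
  refine Measurable.lintegral_prod_right' (f := fun q : ℝ × ℝ =>
    ENNReal.ofReal (Real.exp (-q.1 * q.2 - q.2 ^ 2 / 2))) ?_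
  fun_prop

lemma mul_millsR_le (x : ℝ) : x * millsR x ≤ 1 := by
  rcases le_or_gt x 0 with hx | hx
  · nlinarith [millsR_nonneg x]
  · have h : millsR x ≤ ∫ u in Set.Ioi 0, Real.exp (-x * u) := by
      rw [millsR_eq]
      refine setIntegral_mono (integrable_kern x).integrableOn
        (integrableOn_exp_mul_Ioi (by linarith) 0) fun u => ?_
      apply Real.exp_le_exp.2
      nlinarith [sq_nonneg u]
    rw [integral_exp_mul_Ioi (by linarith) 0] at h
    simp only [mul_zero, Real.exp_zero] at h
    have : -1 / -x = 1 / x := by rw [neg_div_neg_eq]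
    rw [this] at h
    calc x * millsR x ≤ x * (1 / x) := by gcongr
      _ = 1 := by field_simp

lemma lintegral_exp_gauss (t : ℝ) :
    ∫⁻ z, ENNReal.ofReal (Real.exp (t * z)) ∂(gaussianReal 0 1)
      = ENNReal.ofReal (Real.exp (t ^ 2 / 2)) := by
  rw [← ofReal_integral_eq_lintegral_ofReal (integrable_exp_mul_gaussianReal t)
    (Eventually.of_forall fun u => (Real.exp_pos _).le)]
  have := mgf_gaussianReal (p := gaussianReal 0 1) (X := id) (μ := 0) (v := 1) (by simp) t
  simp only [mgf, id] at this
  rw [this]; simp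

lemma lintegral_millsR (p a : ℝ) (h : 0 < p + a) :
    ∫⁻ z, ENNReal.ofReal (millsR (p + z) * Real.exp (a * z)) ∂(gaussianReal 0 1)
      = ENNReal.ofReal (Real.exp (a ^ 2 / 2) / (p + a)) := by
  have e1 : ∀ z, ENNReal.ofReal (millsR (p + z) * Real.exp (a * z)) =
      ∫⁻ u in Set.Ioi (0:ℝ), ENNReal.ofReal (Real.exp (-p * u - u ^ 2 / 2)) *
        ENNReal.ofReal (Real.exp ((a - u) * z)) := by
    intro z
    rw [ENNReal.ofReal_mul (millsR_nonneg _), ofReal_millsR,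
      ← lintegral_mul_const' _ _ ENNReal.ofReal_ne_top]
    congr 1; ext u
    rw [← ENNReal.ofReal_mul (Real.exp_pos _).le, ← ENNReal.ofReal_mul (Real.exp_pos _).le,
      ← Real.exp_add, ← Real.exp_add]
    congr 2; ring
  simp_rw [e1]
  rw [lintegral_lintegral_swap (by
    apply Measurable.aemeasurable
    simp only [Function.uncurry_def]
    fun_prop)]
  have e2 : ∀ u : ℝ, ∫⁻ z, ENNReal.ofReal (Real.exp (-p * u - u ^ 2 / 2)) *
        ENNReal.ofReal (Real.exp ((a - u) * z)) ∂(gaussianReal 0 1) =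
      ENNReal.ofReal (Real.exp (a ^ 2 / 2) * Real.exp (-(p + a) * u)) := by
    intro u
    rw [lintegral_const_mul' _ _ ENNReal.ofReal_ne_top, lintegral_exp_gauss,
      ← ENNReal.ofReal_mul (Real.exp_pos _).le, ← Real.exp_add, ← Real.exp_add]
    congr 2; ring
  simp_rw [e2]
  have hi : IntegrableOn (fun u : ℝ => Real.exp (-(p + a) * u)) (Set.Ioi 0) :=
    integrableOn_exp_mul_Ioi (by linarith) 0
  rw [← ofReal_integral_eq_lintegral_ofReal (hi.const_mul _)
    (Eventually.of_forall fun u => by positivity), integral_const_mul,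
    integral_exp_mul_Ioi (by linarith) 0]
  congr 1
  rw [mul_zero, Real.exp_zero, neg_div_neg_eq]; ring

lemma integrable_millsR (p a : ℝ) (h : 0 < p + a) :
    Integrable (fun z => millsR (p + z) * Real.exp (a * z)) (gaussianReal 0 1) := by
  have hm := measurable_millsR
  refine ⟨Measurable.aestronglyMeasurable (by fun_prop), ?_⟩
  rw [hasFiniteIntegral_iff_ofReal (Eventually.of_forall fun z =>
    mul_nonneg (millsR_nonneg _) (Real.exp_pos _).le), lintegral_millsR p a h]
  exact ENNReal.ofReal_lt_top

lemma integral_millsR (p a : ℝ) (h : 0 < p + a) :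
    ∫ z, millsR (p + z) * Real.exp (a * z) ∂(gaussianReal 0 1)
      = Real.exp (a ^ 2 / 2) / (p + a) := by
  rw [integral_eq_lintegral_of_nonneg_ae (Eventually.of_forall fun z =>
    mul_nonneg (millsR_nonneg _) (Real.exp_pos _).le)
    (integrable_millsR p a h).aestronglyMeasurable, lintegral_millsR p a h,
    ENNReal.toReal_ofReal (by positivity)]

lemma integrable_millsR0 (p : ℝ) (h : 0 < p) :
    Integrable (fun z => millsR (p + z)) (gaussianReal 0 1) := by
  simpa using integrable_millsR p 0 (by simpa)

lemma integral_millsR0 (p : ℝ) (h : 0 < p) :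
    ∫ z, millsR (p + z) ∂(gaussianReal 0 1) = 1 / p := by
  simpa using integral_millsR p 0 (by simpa)

lemma abs_le_exps (z : ℝ) : |z| ≤ 2 * (Real.exp (1/2 * z) + Real.exp (-(1/2) * z)) := by
  have h1 := Real.add_one_le_exp (1/2 * z)
  have h2 := Real.add_one_le_exp (-(1/2) * z)
  have h3 := Real.exp_pos (1/2 * z)
  have h4 := Real.exp_pos (-(1/2) * z)
  rw [abs_le]; constructor <;> linarith

lemma integrable_dev (p : ℝ) (h : 0 < p) :
    Integrable (fun z => |p * millsR (p + z) - 1|) (gaussianReal 0 1) :=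
  (((integrable_millsR0 p h).const_mul p).sub (integrable_const 1)).abs

lemma dev_bound (p : ℝ) (h : 0 < p) :
    p * ∫ z, |p * millsR (p + z) - 1| ∂(gaussianReal 0 1) ≤ 12 * Real.exp (1/8) + 2 := by
  have hi0 := integrable_millsR0 p h
  rcases lt_or_ge p 1 with hp | hp
  · have : ∫ z, |p * millsR (p + z) - 1| ∂(gaussianReal 0 1)
        ≤ ∫ z, (p * millsR (p + z) + 1) ∂(gaussianReal 0 1) := by
      refine integral_mono (integrable_dev p h) ((hi0.const_mul p).add (integrable_const 1)) ?_
      intro z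
      have := mul_nonneg h.le (millsR_nonneg (p + z))
      simp only
      rw [abs_le]; constructor <;> linarith
    rw [integral_add (hi0.const_mul p) (integrable_const 1), integral_const_mul,
      integral_millsR0 p h, mul_one_div_cancel h.ne'] at this
    simp only [integral_const, probReal_univ, smul_eq_mul, mul_one] at this
    have := Real.exp_pos (1/8)
    nlinarith
  · have i1 := integrable_millsR p (1/2) (by linarith)
    have i2 := integrable_millsR p (-(1/2)) (by linarith)
    have i3 : Integrable (fun z => 1 - p * millsR (p + z)) (gaussianReal 0 1) :=
      (integrable_const 1).sub (hi0.const_mul p)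
    have i4 : Integrable (fun z => 4 * (millsR (p + z) * Real.exp (1/2 * z) +
        millsR (p + z) * Real.exp (-(1/2) * z))) (gaussianReal 0 1) := (i1.add i2).const_mul 4
    have : ∫ z, |p * millsR (p + z) - 1| ∂(gaussianReal 0 1)
        ≤ ∫ z, ((1 - p * millsR (p + z)) + 4 * (millsR (p + z) * Real.exp (1/2 * z) +
        millsR (p + z) * Real.exp (-(1/2) * z))) ∂(gaussianReal 0 1) := by
      refine integral_mono (integrable_dev p h) (i3.add i4) ?_
      intro z
      have m0 := millsR_nonneg (p + z)
      have m1 := mul_millsR_le (p + z)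
      have m2 := mul_le_mul_of_nonneg_right (abs_le_exps z) m0
      have m3 := mul_le_mul_of_nonneg_right (le_abs_self z) m0
      have m4 := mul_le_mul_of_nonneg_right (neg_abs_le z) m0
      simp only
      rw [abs_le]; constructor <;> nlinarith
    rw [integral_add i3 i4, integral_sub (integrable_const 1) (hi0.const_mul p),
      integral_const_mul, integral_const_mul, integral_add i1 i2,
      integral_millsR0 p h, mul_one_div_cancel h.ne',
      integral_millsR p (1/2) (by linarith), integral_millsR p (-(1/2)) (by linarith)] at this
    simp only [integral_const, probReal_univ, smul_eq_mul, mul_one, sub_self, zero_add] at this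
    have e1 : Real.exp ((1/2:ℝ)^2/2) = Real.exp (1/8) := by norm_num
    have e2 : Real.exp ((-(1/2):ℝ)^2/2) = Real.exp (1/8) := by norm_num
    rw [e1, e2] at this
    have b1 : Real.exp (1/8) / (p + 1/2) ≤ Real.exp (1/8) / p := by gcongr; linarith
    have b2 : Real.exp (1/8) / (p + -(1/2)) ≤ Real.exp (1/8) / (p/2) := by gcongr; linarith
    have : ∫ z, |p * millsR (p + z) - 1| ∂(gaussianReal 0 1) ≤ 12 * Real.exp (1/8) / p := by
      have e : 4 * (Real.exp (1/8) / p + Real.exp (1/8) / (p/2)) = 12 * Real.exp (1/8) / p := by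
        field_simp; norm_num
      linarith
    calc _ ≤ p * (12 * Real.exp (1/8) / p) := by gcongr
      _ = 12 * Real.exp (1/8) := by field_simp
      _ ≤ _ := by linarith

/-- There is a constant K = K(β, Σ) with π·E|β̂_U − β| ≤ K for all π > 0. -/
theorem stmt8 {Ω : Type*} [MeasurableSpace Ω] (P : Measure Ω) [IsProbabilityMeasure P]
    (Z₁ Z₂ : Ω → ℝ) (hm₁ : Measurable Z₁) (hm₂ : Measurable Z₂)
    (hind : IndepFun Z₁ Z₂ P)
    (hZ₁ : P.map Z₁ = gaussianReal 0 1) (hZ₂ : P.map Z₂ = gaussianReal 0 1)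
    (β σ₁ σ₁₂ σ₂ : ℝ) (hσ₂ : 0 < σ₂)
    (hpd : σ₁₂ ^ 2 < σ₁ ^ 2 * σ₂ ^ 2)
    (ξ₁ : ℝ → Ω → ℝ) (ξ₂ : ℝ → Ω → ℝ)
    (hξ₂ : ∀ π, ξ₂ π = fun ω => π + σ₂ * Z₂ ω)
    (hξ₁ : ∀ π, ξ₁ π = fun ω => π * β + (σ₁₂ / σ₂) * Z₂ ω
        + Real.sqrt (σ₁ ^ 2 - σ₁₂ ^ 2 / σ₂ ^ 2) * Z₁ ω) :
    ∃ K : ℝ, ∀ π : ℝ, 0 < π →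
      π * ∫ ω, |millsTau σ₂ (ξ₂ π ω) * (ξ₁ π ω - (σ₁₂ / σ₂ ^ 2) * ξ₂ π ω)
          + σ₁₂ / σ₂ ^ 2 - β| ∂P ≤ K := by
  have hmm := measurable_millsR
  set s := Real.sqrt (σ₁ ^ 2 - σ₁₂ ^ 2 / σ₂ ^ 2) with hs
  have hs0 : 0 ≤ s := Real.sqrt_nonneg _
  set δ := β - σ₁₂ / σ₂ ^ 2 with hδ
  have hint1 : Integrable (fun ω => |Z₁ ω|) P := by
    have : Integrable (fun z : ℝ => |z|) (gaussianReal 0 1) :=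
      ((memLp_id_gaussianReal 1).integrable le_rfl).abs
    rw [← hZ₁] at this
    exact this.comp_measurable hm₁
  refine ⟨|δ| * σ₂ * (12 * Real.exp (1/8) + 2) + s * ∫ ω, |Z₁ ω| ∂P, fun π hπ => ?_⟩
  set p := π / σ₂ with hp
  have hp0 : 0 < p := div_pos hπ hσ₂
  have hπp : π = p * σ₂ := by rw [hp]; field_simp
  have j1 : Integrable (fun ω => |p * millsR (p + Z₂ ω) - 1|) P := by
    have := integrable_dev p hp0
    rw [← hZ₂] at this
    exact this.comp_measurable hm₂
  have k1 : ∫ ω, |p * millsR (p + Z₂ ω) - 1| ∂P =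
      ∫ z, |p * millsR (p + z) - 1| ∂(gaussianReal 0 1) := by
    rw [← hZ₂, integral_map hm₂.aemeasurable (Measurable.aestronglyMeasurable (by fun_prop))]
  have j2 : Integrable (fun ω => millsR (p + Z₂ ω)) P := by
    have := integrable_millsR0 p hp0
    rw [← hZ₂] at this
    exact this.comp_measurable hm₂
  have k2 : ∫ ω, millsR (p + Z₂ ω) ∂P = 1 / p := by
    rw [← integral_millsR0 p hp0, ← hZ₂, integral_map hm₂.aemeasurable (Measurable.aestronglyMeasurable (by fun_prop))]
  have hind' : IndepFun (fun ω => |Z₁ ω|) (fun ω => millsR (p + Z₂ ω)) P :=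
    hind.comp (φ := fun z => |z|) (ψ := fun z => millsR (p + z)) (by fun_prop) (by fun_prop)
  have j3 : Integrable (fun ω => |Z₁ ω| * millsR (p + Z₂ ω)) P :=
    hind'.integrable_mul hint1 j2
  have k3 : ∫ ω, |Z₁ ω| * millsR (p + Z₂ ω) ∂P = (∫ ω, |Z₁ ω| ∂P) * (1 / p) := by
    rw [hind'.integral_fun_mul_eq_mul_integral hint1.aestronglyMeasurable
      j2.aestronglyMeasurable, k2]
  have key : ∫ ω, |millsTau σ₂ (ξ₂ π ω) * (ξ₁ π ω - (σ₁₂ / σ₂ ^ 2) * ξ₂ π ω)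
          + σ₁₂ / σ₂ ^ 2 - β| ∂P ≤ ∫ ω, (|δ| * |p * millsR (p + Z₂ ω) - 1| +
          s / σ₂ * (|Z₁ ω| * millsR (p + Z₂ ω))) ∂P := by
    refine integral_mono_of_nonneg (Eventually.of_forall fun ω => abs_nonneg _)
      ((j1.const_mul _).add (j3.const_mul _)) (Eventually.of_forall fun ω => ?_)
    have e1 : millsTau σ₂ (ξ₂ π ω) = 1 / σ₂ * millsR (p + Z₂ ω) := by
      have : ξ₂ π ω / σ₂ = p + Z₂ ω := by rw [hξ₂, hp]; field_simp
      unfold millsTau millsR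
      rw [this, mul_div_assoc]
    have e2 : ξ₁ π ω - (σ₁₂ / σ₂ ^ 2) * ξ₂ π ω = p * σ₂ * δ + s * Z₁ ω := by
      rw [hξ₁, hξ₂, hδ, ← hπp]; field_simp; ring
    have e3 : millsTau σ₂ (ξ₂ π ω) * (ξ₁ π ω - (σ₁₂ / σ₂ ^ 2) * ξ₂ π ω)
          + σ₁₂ / σ₂ ^ 2 - β = δ * (p * millsR (p + Z₂ ω) - 1) +
          s / σ₂ * (Z₁ ω * millsR (p + Z₂ ω)) := by
      have : σ₁₂ / σ₂ ^ 2 - β = -δ := by rw [hδ]; ring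
      rw [e1, e2, add_sub_assoc, this]; field_simp; ring
    simp only
    rw [e3]
    refine (abs_add_le _ _).trans (le_of_eq ?_)
    rw [abs_mul, abs_mul, abs_mul, abs_of_nonneg (millsR_nonneg _),
      abs_of_nonneg (div_nonneg hs0 hσ₂.le)]
  rw [integral_add (j1.const_mul _) (j3.const_mul _), integral_const_mul, integral_const_mul,
    k1, k3] at key
  have hd := dev_bound p hp0
  calc _ ≤ π * _ := mul_le_mul_of_nonneg_left key hπ.le
    _ = |δ| * σ₂ * (p * ∫ z, |p * millsR (p + z) - 1| ∂(gaussianReal 0 1)) +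
        s * ∫ ω, |Z₁ ω| ∂P := by rw [hπp]; field_simp
    _ ≤ _ := by gcongr
end

section
/- Let (ξ₁, ξ₂) ~ N((πβ, π)', Σ) with Σ positive definite, and suppose the parameter space contains an open set. Then every unbiased estimator β̃(ξ) of β (i.e., E_{π,β}[β̃] = β for all (π,β)) satisfies E[|β̃|^{1+ε}] = +∞ for every ε > 0 and all (π,β). -/
open MeasureTheory ProbabilityTheory Filter

/-- The joint law of (ξ₁, ξ₂) ~ N((πβ, π)', Σ), realized as the image of two
independent standard normals. -/
noncomputable def ivLaw (σ₁ σ₁₂ σ₂ π β : ℝ) : Measure (ℝ × ℝ) :=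
  ((gaussianReal 0 1).prod (gaussianReal 0 1)).map
    (fun z => (π * β + (σ₁₂ / σ₂) * z.2
        + Real.sqrt (σ₁ ^ 2 - σ₁₂ ^ 2 / σ₂ ^ 2) * z.1, π + σ₂ * z.2))

theorem gauss_shift (m : ℝ) : (gaussianReal 0 1).map (fun x => m + x) =
    (gaussianReal 0 1).withDensity (fun x => ENNReal.ofReal (Real.exp (m * x - m ^ 2 / 2))) := by
  rw [gaussianReal_map_const_add, gaussianReal_of_var_ne_zero _ one_ne_zero,
    gaussianReal_of_var_ne_zero _ one_ne_zero, ← withDensity_mul _ (measurable_gaussianPDF _ _)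
      (by fun_prop)]
  congr 1
  ext x
  simp only [Pi.mul_apply, gaussianPDF]
  rw [← ENNReal.ofReal_mul (gaussianPDFReal_nonneg _ _ _)]
  congr 1
  simp only [gaussianPDFReal, mul_assoc, ← Real.exp_add]
  congr 2
  simp
  ring

theorem gauss2_shift (m n : ℝ) :
    ((gaussianReal 0 1).prod (gaussianReal 0 1)).map (fun z => (m + z.1, n + z.2)) =
    ((gaussianReal 0 1).prod (gaussianReal 0 1)).withDensity
      (fun z => ENNReal.ofReal (Real.exp (m * z.1 + n * z.2 - (m ^ 2 + n ^ 2) / 2))) := by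
  have h := Measure.map_prod_map (gaussianReal 0 1) (gaussianReal 0 1)
    (f := fun x => m + x) (g := fun x => n + x) (by fun_prop) (by fun_prop)
  rw [gauss_shift, gauss_shift, prod_withDensity (by fun_prop) (by fun_prop)] at h
  refine h.symm.trans ?_
  congr 1
  ext z
  rw [← ENNReal.ofReal_mul (by positivity), ← Real.exp_add]
  congr 2
  ring

theorem ivLaw_eq (σ₁ σ₁₂ σ₂ π β m n : ℝ)
    (hm : Real.sqrt (σ₁ ^ 2 - σ₁₂ ^ 2 / σ₂ ^ 2) * m + (σ₁₂ / σ₂) * n = π * β)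
    (hn : σ₂ * n = π) :
    ivLaw σ₁ σ₁₂ σ₂ π β = (((gaussianReal 0 1).prod (gaussianReal 0 1)).withDensity
      (fun z => ENNReal.ofReal (Real.exp (m * z.1 + n * z.2 - (m ^ 2 + n ^ 2) / 2)))).map
      (fun z => ((σ₁₂ / σ₂) * z.2
        + Real.sqrt (σ₁ ^ 2 - σ₁₂ ^ 2 / σ₂ ^ 2) * z.1, σ₂ * z.2)) := by
  rw [← gauss2_shift, Measure.map_map (by fun_prop) (by fun_prop), ivLaw]
  congr 1
  ext z
  · simp only [Function.comp]
    linear_combination -hm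
  · simp only [Function.comp]
    linear_combination -hn

theorem analytic_signed {Ω : Type*} [MeasurableSpace Ω] (μ : Measure Ω) (f X : Ω → ℝ)
    (hf : Measurable f) (hX : Measurable X)
    (hi : ∀ t : ℝ, Integrable (fun ω => f ω * Real.exp (t * X ω)) μ) :
    AnalyticOnNhd ℝ (fun t => ∫ ω, f ω * Real.exp (t * X ω) ∂μ) Set.univ := by
  have key : ∀ g : Ω → ℝ, Measurable g → (∀ ω, 0 ≤ g ω) → (∀ ω, g ω ≤ |f ω|) →
      (∀ t : ℝ, Integrable (fun ω => g ω * Real.exp (t * X ω)) μ) ∧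
      AnalyticOnNhd ℝ (fun t => ∫ ω, g ω * Real.exp (t * X ω) ∂μ) Set.univ := by
    intro g hg h0 h1
    have hI : ∀ t : ℝ, Integrable (fun ω => g ω * Real.exp (t * X ω)) μ := by
      intro t
      refine (hi t).mono (by fun_prop) (Eventually.of_forall fun ω => ?_)
      rw [norm_mul, norm_mul]
      refine mul_le_mul_of_nonneg_right ?_ (norm_nonneg _)
      rw [Real.norm_eq_abs, Real.norm_eq_abs, abs_of_nonneg (h0 ω)]
      exact h1 ω
    refine ⟨hI, ?_⟩
    have hset : integrableExpSet X (μ.withDensity (fun ω => ENNReal.ofReal (g ω))) = Set.univ := by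
      ext t
      simp only [integrableExpSet, Set.mem_ofPred_eq, Set.mem_univ, iff_true]
      rw [integrable_withDensity_iff_integrable_smul' (by fun_prop) (by simp)]
      simpa only [ENNReal.toReal_ofReal (h0 _), smul_eq_mul] using hI t
    have := analyticOnNhd_mgf (X := X) (μ := μ.withDensity (fun ω => ENNReal.ofReal (g ω)))
    rw [hset, interior_univ] at this
    convert this using 2 with t
    rw [mgf, integral_withDensity_eq_integral_toReal_smul (by fun_prop) (by simp)]
    simp only [ENNReal.toReal_ofReal (h0 _), smul_eq_mul]
  obtain ⟨i1, a1⟩ := key (fun ω => max (f ω) 0) (by fun_prop) (fun ω => le_max_right _ _)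
    (fun ω => max_le (le_abs_self _) (abs_nonneg _))
  obtain ⟨i2, a2⟩ := key (fun ω => max (-f ω) 0) (by fun_prop) (fun ω => le_max_right _ _)
    (fun ω => max_le (neg_le_abs _) (abs_nonneg _))
  have : (fun t => ∫ ω, f ω * Real.exp (t * X ω) ∂μ) =
      (fun t => ∫ ω, max (f ω) 0 * Real.exp (t * X ω) ∂μ) -
      (fun t => ∫ ω, max (-f ω) 0 * Real.exp (t * X ω) ∂μ) := by
    ext t
    simp only [Pi.sub_apply]
    rw [← integral_sub (i1 t) (i2 t)]
    congr 1
    ext ω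
    rw [← sub_mul]
    congr 1
    rcases le_total 0 (f ω) with h | h
    · rw [max_eq_left h, max_eq_right (by linarith)]; ring
    · rw [max_eq_right h, max_eq_left (by linarith)]; ring
  rw [this]
  exact a1.sub a2

theorem holder_exp (g : ℝ × ℝ → ℝ) (hg : Measurable g) (p : ℝ) (hp : 1 < p) (m n m' n' : ℝ)
    (h : Integrable (fun z => |g z| ^ p * Real.exp (m * z.1 + n * z.2))
      ((gaussianReal 0 1).prod (gaussianReal 0 1))) :
    Integrable (fun z => g z * Real.exp (m' * z.1 + n' * z.2))
      ((gaussianReal 0 1).prod (gaussianReal 0 1)) := by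
  have hpq := Real.HolderConjugate.conjExponent hp
  set q := Real.conjExponent p
  have hp0 : 0 < p := by linarith
  have hq0 : 0 < q := hpq.symm.pos
  have h2 : Integrable (fun z : ℝ × ℝ => Real.exp ((q * (m' - m / p)) * z.1) *
      Real.exp ((q * (n' - n / p)) * z.2))
      ((gaussianReal 0 1).prod (gaussianReal 0 1)) :=
    (integrable_exp_mul_gaussianReal _).mul_prod (integrable_exp_mul_gaussianReal _)
  refine ((h.div_const p).add (h2.div_const q)).mono' (by fun_prop) (Eventually.of_forall fun z => ?_)
  have hy := Real.young_inequality_of_nonneg (a := |g z| * Real.exp ((m * z.1 + n * z.2) / p))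
    (b := Real.exp ((m' - m / p) * z.1 + (n' - n / p) * z.2)) (by positivity) (by positivity) hpq
  rw [Real.mul_rpow (abs_nonneg _) (by positivity), ← Real.exp_mul, ← Real.exp_mul, mul_assoc,
    ← Real.exp_add] at hy
  rw [norm_mul, Real.norm_eq_abs, Real.norm_eq_abs, Real.abs_exp]
  simp only [Pi.add_apply]
  rw [← Real.exp_add]
  have e1 : (m * z.1 + n * z.2) / p + ((m' - m / p) * z.1 + (n' - n / p) * z.2) =
      m' * z.1 + n' * z.2 := by ring
  have e2 : (m * z.1 + n * z.2) / p * p = m * z.1 + n * z.2 := by field_simp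
  have e3 : ((m' - m / p) * z.1 + (n' - n / p) * z.2) * q =
      q * (m' - m / p) * z.1 + q * (n' - n / p) * z.2 := by ring
  rw [e1, e2, e3] at hy
  exact hy

/-- Any unbiased estimator of β has infinite 1+ε absolute moment at every parameter
value, for every ε > 0, when the parameter space contains an open set. -/
theorem stmt12 (σ₁ σ₁₂ σ₂ : ℝ) (hσ₂ : 0 < σ₂)
    (hpd : σ₁₂ ^ 2 < σ₁ ^ 2 * σ₂ ^ 2)
    (Pi B : Set ℝ) (hPi : Pi ⊆ Set.Ioi 0)
    (hopen : ∃ U : Set (ℝ × ℝ), IsOpen U ∧ U.Nonempty ∧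
        U ⊆ {p | ∃ π ∈ Pi, ∃ β ∈ B, p = (π * β, π)})
    (b : ℝ × ℝ → ℝ) (hb : Measurable b)
    (hunb : ∀ π ∈ Pi, ∀ β ∈ B,
        Integrable b (ivLaw σ₁ σ₁₂ σ₂ π β) ∧ ∫ x, b x ∂(ivLaw σ₁ σ₁₂ σ₂ π β) = β) :
    ∀ ε : ℝ, 0 < ε → ∀ π ∈ Pi, ∀ β ∈ B,
      ∫⁻ x, ENNReal.ofReal (|b x| ^ (1 + ε)) ∂(ivLaw σ₁ σ₁₂ σ₂ π β) = ⊤ := by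
  intro ε hε π₀ hπ₀ β₀ hβ₀
  by_contra hfin
  set s := Real.sqrt (σ₁ ^ 2 - σ₁₂ ^ 2 / σ₂ ^ 2) with hs
  have hs0 : 0 < s := by
    apply Real.sqrt_pos.2
    rw [sub_pos, div_lt_iff₀ (by positivity)]
    exact hpd
  set ρ := σ₁₂ / σ₂ with hρ
  set γ := (gaussianReal 0 1).prod (gaussianReal 0 1) with hγ
  set T : ℝ × ℝ → ℝ × ℝ := fun z => (ρ * z.2 + s * z.1, σ₂ * z.2) with hT
  have hTm : Measurable T := by fun_prop
  set g : ℝ × ℝ → ℝ := fun z => b (T z) with hg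
  have hgm : Measurable g := hb.comp hTm
  -- the moment assumption, in standardized coordinates
  obtain ⟨m, n, hint⟩ : ∃ m n : ℝ, Integrable (fun z => |g z| ^ (1 + ε) *
      Real.exp (m * z.1 + n * z.2)) γ := by
    refine ⟨(π₀ * β₀ - ρ * (π₀ / σ₂)) / s, π₀ / σ₂, ?_⟩
    set n := π₀ / σ₂ with hn
    set m := (π₀ * β₀ - ρ * n) / s with hm
    rw [ivLaw_eq σ₁ σ₁₂ σ₂ π₀ β₀ m n (by rw [← hs, ← hρ, hm]; field_simp; ring)
      (by rw [hn]; field_simp)] at hfin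
    rw [← hs, ← hρ, ← hT, lintegral_map (by fun_prop) hTm,
      lintegral_withDensity_eq_lintegral_mul _ (by fun_prop) (by fun_prop)] at hfin
    have h1 : Integrable (fun z => Real.exp (m * z.1 + n * z.2 - (m ^ 2 + n ^ 2) / 2) *
        |g z| ^ (1 + ε)) γ := by
      refine ⟨by fun_prop, ?_⟩
      rw [hasFiniteIntegral_iff_ofReal (Eventually.of_forall fun z => by positivity)]
      refine lt_of_le_of_ne le_top ?_
      convert hfin using 4 with z
      exact ENNReal.ofReal_mul (Real.exp_nonneg _)
    convert h1.const_mul (Real.exp ((m ^ 2 + n ^ 2) / 2)) using 2 with z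
    rw [← mul_assoc, ← Real.exp_add, mul_comm]
    congr 2
    ring
  have hall : ∀ m' n' : ℝ, Integrable (fun z => g z * Real.exp (m' * z.1 + n' * z.2)) γ :=
    fun m' n' => holder_exp g hgm (1 + ε) (by linarith) m n m' n' hint
  obtain ⟨U, hUo, ⟨u, hu⟩, hUs⟩ := hopen
  -- the parameter set in standardized coordinates
  set V : Set (ℝ × ℝ) := T ⁻¹' U with hV
  have hTc : Continuous T := by fun_prop
  have hVo : IsOpen V := hUo.preimage hTc
  have hv : ((u.1 - ρ * (u.2 / σ₂)) / s, u.2 / σ₂) ∈ V := by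
    have : T ((u.1 - ρ * (u.2 / σ₂)) / s, u.2 / σ₂) = u := by
      ext
      · simp only [hT]; field_simp; ring
      · simp only [hT]; field_simp
    rw [hV, Set.mem_preimage, this]
    exact hu
  obtain ⟨c, hcV, hc0⟩ : ∃ c : ℝ, (c, u.2 / σ₂) ∈ V ∧ c ≠ 0 := by
    have ho : IsOpen {c : ℝ | (c, u.2 / σ₂) ∈ V} :=
      hVo.preimage (by fun_prop : Continuous fun c : ℝ => (c, u.2 / σ₂))
    obtain ⟨c, h1, h2⟩ := (dense_compl_singleton (0 : ℝ)).inter_open_nonempty _ ho ⟨_, hv⟩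
    exact ⟨c, h1, h2⟩
  have hev : ∀ᶠ t in nhds (u.2 / σ₂), (c, t) ∈ V :=
    (hVo.preimage (by fun_prop : Continuous fun t : ℝ => (c, t))).mem_nhds hcV
  have hA := analytic_signed γ (fun z => g z * Real.exp (c * z.1)) (fun z => z.2)
    (by fun_prop) (by fun_prop) (by
      intro t
      convert hall c t using 2 with z
      rw [mul_assoc, ← Real.exp_add])
  set H : ℝ → ℝ := fun t => ∫ z, g z * Real.exp (c * z.1) * Real.exp (t * z.2) ∂γ with hH
  have hL : AnalyticOnNhd ℝ (fun t => σ₂ * t * H t) Set.univ := by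
    refine AnalyticOnNhd.mul (fun t _ => by fun_prop) hA
  have hR : AnalyticOnNhd ℝ (fun t => (s * c + ρ * t) * Real.exp ((c ^ 2 + t ^ 2) / 2)) Set.univ :=
    fun t _ => by fun_prop
  have heq : (fun t => σ₂ * t * H t) =ᶠ[nhds (u.2 / σ₂)]
      (fun t => (s * c + ρ * t) * Real.exp ((c ^ 2 + t ^ 2) / 2)) := by
    filter_upwards [hev] with t ht
    obtain ⟨π, hπ, β, hβ, hp⟩ := hUs ht
    have e1 : ρ * t + s * c = π * β := congrArg Prod.fst hp
    have e2 : σ₂ * t = π := congrArg Prod.snd hp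
    have hE := (hunb π hπ β hβ).2
    rw [ivLaw_eq σ₁ σ₁₂ σ₂ π β c t (by rw [← hs, ← hρ]; linarith) e2, ← hs, ← hρ, ← hT,
      integral_map hTm.aemeasurable hb.aestronglyMeasurable,
      integral_withDensity_eq_integral_toReal_smul (by fun_prop) (by simp)] at hE
    have hH' : H t = Real.exp ((c ^ 2 + t ^ 2) / 2) * β := by
      rw [← hE, ← integral_const_mul]
      refine integral_congr_ae (Eventually.of_forall fun z => ?_)
      simp only [ENNReal.toReal_ofReal (Real.exp_nonneg _), smul_eq_mul]
      rw [← mul_assoc, ← Real.exp_add, mul_assoc, ← Real.exp_add, mul_comm]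
      congr 2
      ring
    rw [hH', e2, show s * c + ρ * t = π * β by linarith]
    ring
  have h0 := hL.eqOn_of_preconnected_of_eventuallyEq hR isPreconnected_univ (Set.mem_univ _) heq
    (Set.mem_univ (0 : ℝ))
  have h0' : s * c * Real.exp ((c ^ 2 + 0 ^ 2) / 2) = 0 := by
    simpa using h0.symm
  exact mul_ne_zero (mul_ne_zero hs0.ne' hc0) (Real.exp_ne_zero _) h0'
end
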